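/- In the descent algebra ΣD_4 of the Coxeter group D_4, the following identity holds: B_{[1,1]} · B_{[2]} = 4 B_{[1,1]} + 2 B_{[1,1,2]} + 4 B_{[1,1,1,1]}, where [1,1] and [2] are taken in C_{<4}, and [1,1,2], [1,1,1,1] are taken in C_1. -/

import Mathlib

open scoped Classical

namespace DescentD

/-- The domain on which the Coxeter group `D_n` acts: the pair `(k, b)` encodes the
integer `k + 1` if `b = true` and `-(k + 1)` if `b = false`.  (We use `Fin (n + 1)`
so that the type is always nonempty; only the points with `k < n` are moved.) -/
abbrev Dom (n : ℕ) := Fin (n + 1) × Bool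

/-- The point of `Dom n` encoding the nonzero integer `a` (for `1 ≤ |a| ≤ n`). -/
def pt (n : ℕ) (a : ℤ) : Dom n :=
  (⟨(a.natAbs - 1) % (n + 1), Nat.mod_lt _ n.succ_pos⟩, decide (0 < a))

/-- The transposition exchanging the points encoding `a` and `b`. -/
def swapD (n : ℕ) (a b : ℤ) : Equiv.Perm (Dom n) := Equiv.swap (pt n a) (pt n b)

/-- The Coxeter generators of `D_n`:  index `0` is `s_{1'} = (-2,1)(-1,2)` and index
`i` with `1 ≤ i ≤ n - 1` is `s_i = (-i-1,-i)(i,i+1)`. -/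
def gen (n : ℕ) (i : ℕ) : Equiv.Perm (Dom n) :=
  if i = 0 then swapD n (-2) 1 * swapD n (-1) 2
  else swapD n (-(i : ℤ) - 1) (-(i : ℤ)) * swapD n (i : ℤ) ((i : ℤ) + 1)

/-- The Coxeter group `D_n`, as the subgroup generated by `s_{1'}, s_1, …, s_{n-1}`. -/
def Dgroup (n : ℕ) : Subgroup (Equiv.Perm (Dom n)) :=
  Subgroup.closure (gen n '' Set.Iio n)

/-- Coxeter length of `w` with respect to the generators of `D_n`. -/
noncomputable def len (n : ℕ) (w : Equiv.Perm (Dom n)) : ℕ :=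
  sInf {k | ∃ l : List ℕ, (∀ i ∈ l, i < n) ∧ l.length = k ∧ (l.map (gen n)).prod = w}

/-- The parabolic subgroup `W_J` for a set `J` of generator indices. -/
def WJ (n : ℕ) (J : Set ℕ) : Subgroup (Equiv.Perm (Dom n)) :=
  Subgroup.closure (gen n '' J)

/-- The set `X_J` of minimal length left coset representatives of `W_J` in `D_n`. -/
def X (n : ℕ) (J : Set ℕ) : Set (Equiv.Perm (Dom n)) :=
  {w | w ∈ Dgroup n ∧ ∀ u ∈ WJ n J, len n w ≤ len n (w * u)}

/-- `𝒳_J`: the sum, in the group algebra `ℚ[D_n]`, of the minimal length left coset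
representatives of `W_J`. -/
noncomputable def XX (n : ℕ) (J : Set ℕ) : MonoidAlgebra ℚ (Equiv.Perm (Dom n)) :=
  ∑ w : Equiv.Perm (Dom n),
    if w ∈ X n J then MonoidAlgebra.of ℚ (Equiv.Perm (Dom n)) w else 0

/-- `q` is a composition of `m`: a list of positive integers with sum `m`. -/
def IsComposition (q : List ℕ) (m : ℕ) : Prop := (∀ x ∈ q, 0 < x) ∧ q.sum = m

/-- The four families making up `C(n)`:  `C_{<n}`, `C_1`, `C_n` and `C_n'`. -/
inductive Kind | lt | one | reg | prime
deriving DecidableEq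

/-- Membership of a composition in each of the four families of `C(n)`. -/
def memC (n : ℕ) : Kind → List ℕ → Prop
  | .lt, q => (∀ x ∈ q, 0 < x) ∧ q.sum + 2 ≤ n
  | .one, q => (∀ x ∈ q, 0 < x) ∧ q.sum = n ∧ q.headD 0 = 1
  | .reg, q => (∀ x ∈ q, 0 < x) ∧ q.sum = n ∧ 2 ≤ q.headD 0
  | .prime, q => (∀ x ∈ q, 0 < x) ∧ q.sum = n ∧ 2 ≤ q.headD 0

/-- The sum of the first `j` components of `q`. -/
def psum (q : List ℕ) (j : ℕ) : ℕ := (q.take j).sum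

/-- The subset of generator indices (`0` standing for `s_{1'}`, `i ≥ 1` for `s_i`)
corresponding to `q ∈ C(n)`. -/
def JofC (n : ℕ) : Kind → List ℕ → Set ℕ
  | .lt, q => {s | ∃ j < q.length, s = (n - q.sum) + psum q j}
  | .one, q => {0} ∪ {s | ∃ j, 1 ≤ j ∧ j < q.length ∧ s = psum q j}
  | .reg, q => {0} ∪ {s | ∃ j, 1 ≤ j ∧ j < q.length ∧ s = psum q j}
  | .prime, q => {1} ∪ {s | ∃ j, 1 ≤ j ∧ j < q.length ∧ s = psum q j}

/-- The basis element `B_q = 𝒳_{J^c}` of `ΣD_n`, for `q` in the family `k` of `C(n)`. -/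
noncomputable def B (n : ℕ) (k : Kind) (q : List ℕ) :
    MonoidAlgebra ℚ (Equiv.Perm (Dom n)) :=
  XX n (Set.Iio n \ JofC n k q)

/-! ### Numerical codes for signed permutations

A point of `Dom 4` is coded by a digit, and a permutation `w` commuting with negation by the number
whose base-16 digits are the codes of the images under `w` of the positive points. -/

/-- The code `2 k` of the positive point `(k, true)`, or `2 k + 1` of its negative. -/
def pointCode (x : Dom 4) : ℕ := 2 * x.1.val + bif x.2 then 0 else 1

/-- The `j`-th base-16 digit of `c`. -/
def digit (c j : ℕ) : ℕ := c / 16 ^ j % 16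

/-- The number whose base-16 digits are `f 0, …, f 4`. -/
def ofDigitFun (f : ℕ → ℕ) : ℕ := f 0 + 16 * (f 1 + 16 * (f 2 + 16 * (f 3 + 16 * f 4)))

/-- The code of a permutation. -/
def permCode (w : Equiv.Perm (Dom 4)) : ℕ :=
  ofDigitFun fun j => pointCode (w (Fin.ofNat 5 j, true))

/-- Product of permutation codes. -/
def mulCode (c d : ℕ) : ℕ :=
  ofDigitFun fun j => digit c (digit d j / 2) ^^^ (digit d j % 2)

/-- The code of the identity. -/
def oneCode : ℕ := 0 + 16 * (2 + 16 * (4 + 16 * (6 + 16 * 8)))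

/-- The codes of the Coxeter generators of `D_4`. -/
def genCode : ℕ → ℕ
  | 0 => 3 + 16 * (1 + 16 * (4 + 16 * (6 + 16 * 8)))
  | 1 => 2 + 16 * (0 + 16 * (4 + 16 * (6 + 16 * 8)))
  | 2 => 0 + 16 * (4 + 16 * (2 + 16 * (6 + 16 * 8)))
  | _ => 0 + 16 * (2 + 16 * (6 + 16 * (4 + 16 * 8)))

/-- Position of a coded point in the order `-5 < ⋯ < -1 < 1 < ⋯ < 5`. -/
def rank (e : ℕ) : ℕ := bif Nat.beq (e % 2) 0 then 5 + e / 2 else 4 - e / 2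

/-- Contribution of two values `a`, `b` to the length: `1` if `a > b`, plus `1` if `a + b < 0`. -/
def invPair (a b : ℕ) : ℕ :=
  (bif Nat.blt (rank b) (rank a) then 1 else 0) + bif Nat.blt (rank b + rank a) 9 then 1 else 0

/-- The number of type `D` inversions of a coded permutation. -/
def inv (c : ℕ) : ℕ :=
  let p (i j : ℕ) := invPair (digit c i) (digit c j)
  p 0 1 + p 0 2 + p 0 3 + p 1 2 + p 1 3 + p 2 3

/-- The codes of the elements of length `k` in the parabolic subgroup generated by `J`. -/
def layer (J : List ℕ) : ℕ → List ℕ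
  | 0 => [oneCode]
  | k + 1 => (((layer J k).flatMap fun c => J.map fun i => mulCode c (genCode i)).filter
      fun c => (inv c).beq (k + 1)).dedup

/-- The codes of the elements of the parabolic subgroup generated by `J`. -/
def elems (J : List ℕ) : List ℕ := (List.range 13).flatMap (layer J)

/-- The indices of all generators. -/
abbrev allGens : List ℕ := [0, 1, 2, 3]

/-- The codes of the minimal length left coset representatives. -/
def minReps (J : List ℕ) : List ℕ :=
  (elems allGens).filter fun c => (elems J).all fun u => (inv c).ble (inv (mulCode c u))

/-- `w` commutes with negation. -/
def IsSigned (w : Equiv.Perm (Dom 4)) : Prop := ∀ x : Dom 4, w (x.1, !x.2) = ((w x).1, !(w x).2)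

theorem IsSigned.mul {w u : Equiv.Perm (Dom 4)} (hw : IsSigned w) (hu : IsSigned u) :
    IsSigned (w * u) := fun x => by
  rw [Equiv.Perm.mul_apply, hu x, hw (u x), Equiv.Perm.mul_apply]

theorem isSigned_one : IsSigned 1 := fun _ => rfl

theorem isSigned_gen {i : ℕ} (hi : i < 4) : IsSigned (gen 4 i) := by
  have h : ∀ i < 4, ∀ x : Dom 4, gen 4 i (x.1, !x.2) = ((gen 4 i x).1, !(gen 4 i x).2) := by
    decide +kernel
  exact h i hi

theorem gen_mul_self {i : ℕ} (hi : i < 4) : gen 4 i * gen 4 i = 1 := by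
  have h : ∀ i < 4, ∀ x : Dom 4, gen 4 i (gen 4 i x) = x := by decide +kernel
  exact Equiv.ext (h i hi)

theorem pointCode_lt (x : Dom 4) : pointCode x < 16 := by
  revert x; decide +kernel

theorem pointCode_injective : Function.Injective pointCode := by
  have h : ∀ x y : Dom 4, pointCode x = pointCode y → x = y := by decide +kernel
  exact h

theorem pointCode_neg (x : Dom 4) : pointCode (x.1, !x.2) = pointCode x ^^^ 1 := by
  revert x; decide +kernel

theorem digit_permCode (w : Equiv.Perm (Dom 4)) {j : ℕ} (hj : j < 5) :
    digit (permCode w) j = pointCode (w (Fin.ofNat 5 j, true)) := by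
  have h (k : ℕ) := pointCode_lt (w (Fin.ofNat 5 k, true))
  have h0 := h 0
  have h1 := h 1
  have h2 := h 2
  have h3 := h 3
  have h4 := h 4
  unfold digit permCode ofDigitFun
  interval_cases j <;> norm_num only <;> omega

theorem digit_xor_permCode {w : Equiv.Perm (Dom 4)} (hw : IsSigned w) (x : Dom 4) :
    digit (permCode w) (pointCode x / 2) ^^^ (pointCode x % 2) = pointCode (w x) := by
  obtain ⟨k, b⟩ := x
  have hk : Fin.ofNat 5 k.val = k := by ext; simp
  cases b
  · have h1 : pointCode (k, false) / 2 = k.val := by simp [pointCode]; omega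
    have h2 : pointCode (k, false) % 2 = 1 := by simp [pointCode]
    have h3 := hw (k, true)
    rw [h1, h2, digit_permCode w k.isLt, hk, ← pointCode_neg]
    exact congrArg pointCode h3.symm
  · have h1 : pointCode (k, true) / 2 = k.val := by simp [pointCode]
    have h2 : pointCode (k, true) % 2 = 0 := by simp [pointCode]
    rw [h1, h2, digit_permCode w k.isLt, hk, Nat.xor_zero]

theorem permCode_mul {w : Equiv.Perm (Dom 4)} (hw : IsSigned w) (u : Equiv.Perm (Dom 4)) :
    permCode (w * u) = mulCode (permCode w) (permCode u) := by
  have h {j : ℕ} (hj : j < 5) : pointCode ((w * u) (Fin.ofNat 5 j, true)) =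
      digit (permCode w) (digit (permCode u) j / 2) ^^^ (digit (permCode u) j % 2) := by
    rw [digit_permCode u hj, digit_xor_permCode hw, Equiv.Perm.mul_apply]
  rw [mulCode, permCode, ofDigitFun, ofDigitFun, h (j := 0) (by norm_num),
    h (j := 1) (by norm_num), h (j := 2) (by norm_num), h (j := 3) (by norm_num),
    h (j := 4) (by norm_num)]

theorem permCode_one : permCode 1 = oneCode := by decide +kernel

theorem permCode_gen {i : ℕ} (hi : i < 4) : permCode (gen 4 i) = genCode i := by
  have h : ∀ i < 4, permCode (gen 4 i) = genCode i := by decide +kernel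
  exact h i hi

theorem IsSigned.ext_permCode {w u : Equiv.Perm (Dom 4)} (hw : IsSigned w) (hu : IsSigned u)
    (h : permCode w = permCode u) : w = u :=
  Equiv.ext fun x => pointCode_injective <| by
    rw [← digit_xor_permCode hw, ← digit_xor_permCode hu, h]

/-! ### Words and lengths -/

theorem isSigned_word {l : List ℕ} (hl : ∀ i ∈ l, i < 4) : IsSigned (l.map (gen 4)).prod := by
  induction l with
  | nil => exact isSigned_one
  | cons a l ih =>
    rw [List.map_cons, List.prod_cons]
    exact (isSigned_gen (hl a (by simp))).mul (ih fun i hi => hl i (by simp [hi]))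

theorem word_mem_WJ {J : Set ℕ} {l : List ℕ} (hl : ∀ i ∈ l, i ∈ J) :
    (l.map (gen 4)).prod ∈ WJ 4 J := by
  refine Subgroup.list_prod_mem _ fun x hx => ?_
  obtain ⟨i, hi, rfl⟩ := List.mem_map.1 hx
  exact Subgroup.subset_closure ⟨i, hl i hi, rfl⟩

theorem permCode_word_append {l : List ℕ} (hl : ∀ i ∈ l, i < 4) {i : ℕ} (hi : i < 4) :
    permCode ((l ++ [i]).map (gen 4)).prod =
      mulCode (permCode (l.map (gen 4)).prod) (genCode i) := by
  rw [List.map_append, List.prod_append, List.map_singleton, List.prod_singleton,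
    permCode_mul (isSigned_word hl), permCode_gen hi]

theorem exists_word_of_mem_layer {J : List ℕ} (hJ : ∀ i ∈ J, i < 4) {k c : ℕ}
    (hc : c ∈ layer J k) :
    ∃ l : List ℕ, (∀ i ∈ l, i ∈ J) ∧ l.length = k ∧ permCode (l.map (gen 4)).prod = c := by
  induction k generalizing c with
  | zero =>
    refine ⟨[], by simp, rfl, ?_⟩
    rw [List.mem_singleton.1 hc]
    exact permCode_one
  | succ k ih =>
    simp only [layer, List.mem_dedup, List.mem_filter, List.mem_flatMap, List.mem_map] at hc
    obtain ⟨⟨d, hd, i, hi, rfl⟩, -⟩ := hc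
    obtain ⟨l, hl, rfl, rfl⟩ := ih hd
    refine ⟨l ++ [i], ?_, by simp, permCode_word_append (fun j hj => hJ j (hl j hj)) (hJ i hi)⟩
    intro j hj
    rcases List.mem_append.1 hj with hj | hj
    · exact hl j hj
    · rwa [List.mem_singleton.1 hj]

theorem inv_of_mem_layer {J : List ℕ} {k c : ℕ} (hc : c ∈ layer J k) : inv c = k := by
  cases k with
  | zero =>
    rw [List.mem_singleton.1 hc]
    decide +kernel
  | succ k =>
    simp only [layer, List.mem_dedup, List.mem_filter] at hc
    exact Nat.eq_of_beq_eq_true hc.2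

theorem exists_word_of_mem_elems {J : List ℕ} (hJ : ∀ i ∈ J, i < 4) {c : ℕ} (hc : c ∈ elems J) :
    ∃ l : List ℕ, (∀ i ∈ l, i ∈ J) ∧ l.length = inv c ∧ permCode (l.map (gen 4)).prod = c := by
  obtain ⟨k, -, hk⟩ := List.mem_flatMap.1 hc
  rw [inv_of_mem_layer hk]
  exact exists_word_of_mem_layer hJ hk

/-- The list `elems J` is closed under right multiplication by the generators in `J`. -/
def IsClosed (J : List ℕ) : Prop :=
  ∀ c ∈ elems J, ∀ i ∈ J, mulCode c (genCode i) ∈ elems J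

theorem oneCode_mem_elems (J : List ℕ) : oneCode ∈ elems J :=
  List.mem_flatMap.2 ⟨0, by simp, List.mem_singleton.2 rfl⟩

theorem isSigned_and_permCode_mem_elems {J : List ℕ} (hJ : ∀ i ∈ J, i < 4) (hc : IsClosed J)
    {w : Equiv.Perm (Dom 4)} (hw : w ∈ WJ 4 {i | i ∈ J}) :
    IsSigned w ∧ permCode w ∈ elems J := by
  have key (x : Equiv.Perm (Dom 4)) (i : ℕ) (hi : i ∈ J)
      (hx : IsSigned x ∧ permCode x ∈ elems J) :
      IsSigned (x * gen 4 i) ∧ permCode (x * gen 4 i) ∈ elems J := by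
    refine ⟨hx.1.mul (isSigned_gen (hJ i hi)), ?_⟩
    rw [permCode_mul hx.1, permCode_gen (hJ i hi)]
    exact hc _ hx.2 i hi
  unfold WJ at hw
  induction hw using Subgroup.closure_induction_right with
  | one => exact ⟨isSigned_one, permCode_one ▸ oneCode_mem_elems J⟩
  | mul_right x hx y hy ih =>
    obtain ⟨i, hi, rfl⟩ := hy
    exact key x i hi ih
  | mul_inv_cancel x hx y hy ih =>
    obtain ⟨i, hi, rfl⟩ := hy
    rw [inv_eq_of_mul_eq_one_left (gen_mul_self (hJ i hi))]
    exact key x i hi ih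

theorem lt_of_mem_allGens : ∀ i ∈ allGens, i < 4 := by decide

theorem mem_allGens {i : ℕ} : i ∈ allGens ↔ i < 4 := by
  simp only [List.mem_cons, List.not_mem_nil, or_false]
  omega

theorem Dgroup_eq : Dgroup 4 = WJ 4 {i | i ∈ allGens} := by
  have h : {i | i ∈ allGens} = Set.Iio 4 := Set.ext fun _ => mem_allGens
  rw [h]
  rfl

theorem mulCode_genCode_mem_and_inv_le : ∀ c ∈ elems allGens, ∀ i ∈ allGens,
    mulCode c (genCode i) ∈ elems allGens ∧
      (inv (mulCode c (genCode i))).ble (inv c + 1) = true := by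
  decide +kernel

theorem isClosed_allGens : IsClosed allGens := fun c hc i hi =>
  (mulCode_genCode_mem_and_inv_le c hc i hi).1

theorem isSigned_of_mem_Dgroup {w : Equiv.Perm (Dom 4)} (hw : w ∈ Dgroup 4) : IsSigned w :=
  (isSigned_and_permCode_mem_elems lt_of_mem_allGens isClosed_allGens (Dgroup_eq ▸ hw)).1

theorem permCode_mem_elems_allGens {w : Equiv.Perm (Dom 4)} (hw : w ∈ Dgroup 4) :
    permCode w ∈ elems allGens :=
  (isSigned_and_permCode_mem_elems lt_of_mem_allGens isClosed_allGens (Dgroup_eq ▸ hw)).2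

theorem inv_permCode_word_le (l : List ℕ) (hl : ∀ i ∈ l, i < 4) :
    inv (permCode (l.map (gen 4)).prod) ≤ l.length := by
  induction l using List.reverseRecOn with
  | nil =>
    rw [List.map_nil, List.prod_nil, permCode_one]
    decide +kernel
  | append_singleton l i ih =>
    have hl' : ∀ j ∈ l, j < 4 := fun j hj => hl j (by simp [hj])
    have hi : i < 4 := hl i (by simp)
    have hmem : (l.map (gen 4)).prod ∈ Dgroup 4 := word_mem_WJ (J := Set.Iio 4) hl'
    have h := Nat.le_of_ble_eq_true (mulCode_genCode_mem_and_inv_le _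
      (permCode_mem_elems_allGens hmem) i (mem_allGens.2 hi)).2
    rw [permCode_word_append hl' hi, List.length_append, List.length_singleton]
    exact h.trans (Nat.add_le_add_right (ih hl') 1)

theorem len_eq_inv {w : Equiv.Perm (Dom 4)} (hw : w ∈ Dgroup 4) : len 4 w = inv (permCode w) := by
  obtain ⟨l, hl, hlen, hcode⟩ :=
    exists_word_of_mem_elems lt_of_mem_allGens (permCode_mem_elems_allGens hw)
  have hl' : ∀ i ∈ l, i < 4 := fun i hi => mem_allGens.1 (hl i hi)
  have hmem : inv (permCode w) ∈ {k | ∃ l : List ℕ,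
      (∀ i ∈ l, i < 4) ∧ l.length = k ∧ (l.map (gen 4)).prod = w} :=
    ⟨l, hl', hlen, (isSigned_word hl').ext_permCode (isSigned_of_mem_Dgroup hw) hcode⟩
  refine le_antisymm (Nat.sInf_le hmem) (le_csInf ⟨_, hmem⟩ ?_)
  rintro k ⟨m, hm, rfl, rfl⟩
  exact inv_permCode_word_le m hm

/-! ### Minimal coset representatives -/

theorem mem_X_iff {J : List ℕ} (hJ : ∀ i ∈ J, i < 4) (hc : IsClosed J)
    {w : Equiv.Perm (Dom 4)} (hw : w ∈ Dgroup 4) :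
    w ∈ X 4 {i | i ∈ J} ↔ permCode w ∈ minReps J := by
  have hsub : WJ 4 {i | i ∈ J} ≤ Dgroup 4 := Subgroup.closure_mono (Set.image_mono hJ)
  have hlen {u : Equiv.Perm (Dom 4)} (hu : u ∈ WJ 4 {i | i ∈ J}) :
      len 4 (w * u) = inv (mulCode (permCode w) (permCode u)) := by
    rw [len_eq_inv (mul_mem hw (hsub hu)), permCode_mul (isSigned_of_mem_Dgroup hw)]
  simp only [X, minReps, Set.mem_ofPred_eq, hw, true_and, List.mem_filter,
    permCode_mem_elems_allGens hw, List.all_eq_true, Nat.ble_eq, len_eq_inv hw]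
  constructor
  · intro h c hcJ
    obtain ⟨l, hl, -, rfl⟩ := exists_word_of_mem_elems hJ hcJ
    have hu := word_mem_WJ (J := {i | i ∈ J}) hl
    rw [← hlen hu]
    exact h _ hu
  · intro h u hu
    rw [hlen hu]
    exact h _ (isSigned_and_permCode_mem_elems hJ hc hu).2

/-- The element of `D_4` with a given code. -/
noncomputable def decode : ℕ → Equiv.Perm (Dom 4) := Function.invFunOn permCode (Dgroup 4)

theorem decode_permCode {w : Equiv.Perm (Dom 4)} (hw : w ∈ Dgroup 4) : decode (permCode w) = w :=
  Set.InjOn.leftInvOn_invFunOn (s := (Dgroup 4 : Set (Equiv.Perm (Dom 4))))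
    (fun _ hx _ hy h => (isSigned_of_mem_Dgroup hx).ext_permCode (isSigned_of_mem_Dgroup hy) h) hw

theorem exists_permCode_eq {c : ℕ} (hc : c ∈ elems allGens) : ∃ w ∈ Dgroup 4, permCode w = c := by
  obtain ⟨l, hl, -, h⟩ := exists_word_of_mem_elems lt_of_mem_allGens hc
  exact ⟨_, Dgroup_eq ▸ word_mem_WJ (J := {i | i ∈ allGens}) hl, h⟩

theorem decode_mulCode {c d : ℕ} (hc : c ∈ elems allGens) (hd : d ∈ elems allGens) :
    decode (mulCode c d) = decode c * decode d := by
  obtain ⟨w, hw, rfl⟩ := exists_permCode_eq hc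
  obtain ⟨u, hu, rfl⟩ := exists_permCode_eq hd
  rw [← permCode_mul (isSigned_of_mem_Dgroup hw), decode_permCode hw, decode_permCode hu,
    decode_permCode (mul_mem hw hu)]

/-- The group algebra element with a given code. -/
noncomputable def single (c : ℕ) : MonoidAlgebra ℚ (Equiv.Perm (Dom 4)) :=
  MonoidAlgebra.of ℚ _ (decode c)

theorem nodup_elems_allGens : (elems allGens).Nodup := by decide +kernel

theorem mem_elems_of_mem_minReps {J : List ℕ} {c : ℕ} (hc : c ∈ minReps J) :
    c ∈ elems allGens := (List.mem_filter.1 hc).1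

theorem XX_eq_sum {J : List ℕ} (hJ : ∀ i ∈ J, i < 4) (hc : IsClosed J) :
    XX 4 {i | i ∈ J} = ((minReps J).map single).sum := by
  have hnodup : (minReps J).Nodup := nodup_elems_allGens.filter _
  rw [XX, ← Finset.sum_filter, ← List.sum_toFinset single hnodup]
  refine Finset.sum_bij (fun w _ => permCode w) ?_ ?_ ?_ ?_
  · intro w hw
    have h := (Finset.mem_filter.1 hw).2
    exact List.mem_toFinset.2 ((mem_X_iff hJ hc h.1).1 h)
  · intro w hw u hu h
    exact (isSigned_of_mem_Dgroup (Finset.mem_filter.1 hw).2.1).ext_permCode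
      (isSigned_of_mem_Dgroup (Finset.mem_filter.1 hu).2.1) h
  · intro c hcJ
    rw [List.mem_toFinset] at hcJ
    obtain ⟨w, hw, rfl⟩ := exists_permCode_eq (mem_elems_of_mem_minReps hcJ)
    exact ⟨w, Finset.mem_filter.2 ⟨Finset.mem_univ _, (mem_X_iff hJ hc hw).2 hcJ⟩, rfl⟩
  · intro w hw
    rw [single, decode_permCode (Finset.mem_filter.1 hw).2.1]

theorem sum_single_mul_sum_single {l m : List ℕ} (hl : ∀ c ∈ l, c ∈ elems allGens)
    (hm : ∀ c ∈ m, c ∈ elems allGens) :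
    (l.map single).sum * (m.map single).sum =
      ((l.flatMap fun c => m.map (mulCode c)).map single).sum := by
  induction l with
  | nil => simp
  | cons a l ih =>
    rw [List.map_cons, List.sum_cons, add_mul, ih fun c hc => hl c (by simp [hc]),
      List.flatMap_cons, List.map_append, List.sum_append, ← List.sum_map_mul_left, List.map_map]
    congr 2
    refine List.map_congr_left fun d hd => ?_
    rw [Function.comp_apply, single, single, single, decode_mulCode (hl a (by simp)) (hm d hd),
      map_mul]

theorem sum_map_replicate_flatten (k : ℕ) (l : List ℕ) :
    ((List.replicate k l).flatten.map single).sum = (k : ℚ) • (l.map single).sum := by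
  induction k with
  | zero => simp
  | succ k ih =>
    rw [List.replicate_succ, List.flatten_cons, List.map_append, List.sum_append, ih,
      Nat.cast_succ, add_smul, one_smul, add_comm]

theorem minReps_mul_perm : List.Perm
    ((minReps [0, 1]).flatMap fun c => (minReps [0, 1, 3]).map (mulCode c))
    ((List.replicate 4 (minReps [0, 1])).flatten ++ (List.replicate 2 (minReps [3])).flatten ++
      (List.replicate 4 (minReps [])).flatten) := by
  decide +kernel

/-! ### The basis elements -/

theorem B_lt_one_one : B 4 Kind.lt [1, 1] = ((minReps [0, 1]).map single).sum := by
  have h : Set.Iio 4 \ JofC 4 Kind.lt [1, 1] = {i | i ∈ [0, 1]} := by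
    ext s
    have hP : (∃ j < 2, s = 2 + psum [1, 1] j) ↔ s = 2 ∨ s = 3 := by
      constructor
      · rintro ⟨j, hj, rfl⟩
        interval_cases j <;> decide
      · rintro (rfl | rfl)
        exacts [⟨0, by decide⟩, ⟨1, by decide⟩]
    change (s < 4 ∧ ¬ ∃ j < 2, s = 2 + psum [1, 1] j) ↔ s ∈ [0, 1]
    rw [hP]
    simp only [List.mem_cons, List.not_mem_nil, or_false]
    omega
  rw [B, h, XX_eq_sum (by decide) (by unfold IsClosed; decide +kernel)]

theorem B_lt_two : B 4 Kind.lt [2] = ((minReps [0, 1, 3]).map single).sum := by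
  have h : Set.Iio 4 \ JofC 4 Kind.lt [2] = {i | i ∈ [0, 1, 3]} := by
    ext s
    have hP : (∃ j < 1, s = 2 + psum [2] j) ↔ s = 2 := by
      simp [psum]
    change (s < 4 ∧ ¬ ∃ j < 1, s = 2 + psum [2] j) ↔ s ∈ [0, 1, 3]
    rw [hP]
    simp only [List.mem_cons, List.not_mem_nil, or_false]
    omega
  rw [B, h, XX_eq_sum (by decide) (by unfold IsClosed; decide +kernel)]

theorem B_one_one_one_two : B 4 Kind.one [1, 1, 2] = ((minReps [3]).map single).sum := by
  have h : Set.Iio 4 \ JofC 4 Kind.one [1, 1, 2] = {i | i ∈ [3]} := by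
    ext s
    have hP : (∃ j, 1 ≤ j ∧ j < 3 ∧ s = psum [1, 1, 2] j) ↔ s = 1 ∨ s = 2 := by
      constructor
      · rintro ⟨j, h1, h2, rfl⟩
        interval_cases j <;> decide
      · rintro (rfl | rfl)
        exacts [⟨1, by decide⟩, ⟨2, by decide⟩]
    change (s < 4 ∧ ¬ (s = 0 ∨ ∃ j, 1 ≤ j ∧ j < 3 ∧ s = psum [1, 1, 2] j)) ↔ s ∈ [3]
    rw [hP, List.mem_singleton]
    omega
  rw [B, h, XX_eq_sum (by decide) (by unfold IsClosed; decide +kernel)]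

theorem B_one_ones : B 4 Kind.one [1, 1, 1, 1] = ((minReps []).map single).sum := by
  have h : Set.Iio 4 \ JofC 4 Kind.one [1, 1, 1, 1] = {i | i ∈ ([] : List ℕ)} := by
    ext s
    have hP : (∃ j, 1 ≤ j ∧ j < 4 ∧ s = psum [1, 1, 1, 1] j) ↔ s = 1 ∨ s = 2 ∨ s = 3 := by
      constructor
      · rintro ⟨j, h1, h2, rfl⟩
        interval_cases j <;> decide
      · rintro (rfl | rfl | rfl)
        exacts [⟨1, by decide⟩, ⟨2, by decide⟩, ⟨3, by decide⟩]
    change (s < 4 ∧ ¬ (s = 0 ∨ ∃ j, 1 ≤ j ∧ j < 4 ∧ s = psum [1, 1, 1, 1] j)) ↔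
      s ∈ ([] : List ℕ)
    rw [hP]
    simp only [List.not_mem_nil, iff_false]
    omega
  rw [B, h, XX_eq_sum (by decide) (by unfold IsClosed; decide +kernel)]

/-- Example: `B_[1,1] B_[2] = 4B_[1,1] + 2B_[1,1,2] + 4B_[1,1,1,1]` in `ΣD_4`. -/
theorem example_mult_6 :
    B 4 Kind.lt [1, 1] * B 4 Kind.lt [2] =
      (4 : ℚ) • B 4 Kind.lt [1, 1] + (2 : ℚ) • B 4 Kind.one [1, 1, 2] +
        (4 : ℚ) • B 4 Kind.one [1, 1, 1, 1] := by
  rw [B_lt_one_one, B_lt_two, B_one_one_one_two, B_one_ones,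
    sum_single_mul_sum_single (fun _ => mem_elems_of_mem_minReps)
      (fun _ => mem_elems_of_mem_minReps),
    (minReps_mul_perm.map single).sum_eq, List.map_append, List.map_append, List.sum_append,
    List.sum_append, sum_map_replicate_flatten, sum_map_replicate_flatten,
    sum_map_replicate_flatten]
  norm_num

end DescentD
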